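/- arXiv:1901.03980 — 3 statements merged into one kernel-verified Lean document; each statement's English description precedes it below -/
import Mathlib

section
/- Let G be an additively written cyclic group of order n ≥ 3 and let S be a zero-sum free sequence over G of length |S| = n - 1. Then there exists g ∈ G with ord(g) = n such that S = g^{[n-1]}. -/
/-- A sequence is *zero-sum free* if no non-empty subsequence (multiset divisor)
has sum zero. -/
def IsZeroSumFree {G : Type*} [AddCommGroup G] (S : Multiset G) : Prop :=
  ∀ T : Multiset G, T ≤ S → T ≠ 0 → T.sum ≠ 0

open Classical in
/-- All sums of (possibly empty) subsequences. -/
noncomputable def subSums {G : Type*} [AddCommGroup G] (S : Multiset G) : Finset G :=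
  (S.powerset.map Multiset.sum).toFinset

lemma mem_subSums {G : Type*} [AddCommGroup G] (S : Multiset G) (x : G) :
    x ∈ subSums S ↔ ∃ T ≤ S, T.sum = x := by
  simp [subSums]

lemma card_subSums_cons {G : Type*} [AddCommGroup G] (S : Multiset G) (x : G)
    (h : IsZeroSumFree (x ::ₘ S)) : (subSums S).card + 1 ≤ (subSums (x ::ₘ S)).card := by
  apply Finset.card_lt_card
  refine Finset.ssubset_iff_subset_ne.2 ⟨?_, ?_⟩
  · intro y hy
    rw [mem_subSums] at hy ⊢
    obtain ⟨T, hT, rfl⟩ := hy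
    exact ⟨T, hT.trans (Multiset.le_cons_self _ _), rfl⟩
  · intro heq
    have hmaps : ∀ y ∈ subSums S, y + x ∈ subSums S := by
      intro y hy
      rw [heq]
      rw [mem_subSums] at hy ⊢
      obtain ⟨T, hT, rfl⟩ := hy
      exact ⟨x ::ₘ T, Multiset.cons_le_cons _ hT, by simp [add_comm]⟩
    have hsurj := Finset.surj_on_of_inj_on_of_card_le (s := subSums S) (t := subSums S)
      (fun y _ => y + x) hmaps (by intro a b _ _ hab; exact add_right_cancel hab) le_rfl
    obtain ⟨y, hy, h0⟩ := hsurj 0 ((mem_subSums _ _).2 ⟨0, Multiset.zero_le _, by simp⟩)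
    rw [mem_subSums] at hy
    obtain ⟨T, hT, rfl⟩ := hy
    refine h (x ::ₘ T) (Multiset.cons_le_cons _ hT) (Multiset.cons_ne_zero) ?_
    rw [Multiset.sum_cons, add_comm]
    exact h0.symm

lemma card_subSums_add {G : Type*} [AddCommGroup G] (B R : Multiset G)
    (h : IsZeroSumFree (R + B)) :
    (subSums B).card + Multiset.card R ≤ (subSums (R + B)).card := by
  induction R using Multiset.induction_on with
  | empty => simp
  | cons x R ih =>
    rw [Multiset.cons_add] at h ⊢
    have h1 := card_subSums_cons _ _ h
    have h2 := ih (fun T hT => h T (hT.trans (Multiset.le_cons_self _ _)))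
    rw [Multiset.card_cons]
    omega

lemma four_le_subSums {G : Type*} [AddCommGroup G] (a b : G) (hab : a ≠ b)
    (h : IsZeroSumFree (a ::ₘ b ::ₘ 0)) : 4 ≤ (subSums (a ::ₘ b ::ₘ 0)).card := by
  classical
  have ha : a ≠ 0 := by simpa using h (a ::ₘ 0) (Multiset.cons_le_cons _ (Multiset.zero_le _)) (by simp)
  have hb : b ≠ 0 := by simpa using h (b ::ₘ 0) (Multiset.le_cons_self _ _) (by simp)
  have hs : a + b ≠ 0 := by simpa using h _ le_rfl (by simp)
  have hc : ({0, a, b, a + b} : Finset G).card = 4 := by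
    rw [Finset.card_insert_of_notMem, Finset.card_insert_of_notMem, Finset.card_pair] <;>
      simp [ha, hb, hab, ha.symm, hb.symm, hs.symm]
  rw [← hc]
  apply Finset.card_le_card
  intro y hy
  rw [mem_subSums]
  simp only [Finset.mem_insert, Finset.mem_singleton] at hy
  rcases hy with rfl | rfl | rfl | rfl
  · exact ⟨0, Multiset.zero_le _, by simp⟩
  · exact ⟨y ::ₘ 0, Multiset.cons_le_cons _ (Multiset.zero_le _), by simp⟩
  · exact ⟨y ::ₘ 0, Multiset.le_cons_self _ _, by simp⟩
  · exact ⟨_, le_rfl, by simp⟩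

theorem zero_sum_free_of_length_sub_one
    (n : ℕ) (hn : 3 ≤ n)
    (G : Type*) [AddCommGroup G] [Fintype G] (hcyc : IsAddCyclic G)
    (hcard : Fintype.card G = n)
    (S : Multiset G) (hzsf : IsZeroSumFree S) (hlen : Multiset.card S = n - 1) :
    ∃ g : G, addOrderOf g = n ∧ S = Multiset.replicate (n - 1) g := by
  obtain ⟨g, hg⟩ : ∃ g, g ∈ S := Multiset.card_pos_iff_exists_mem.1 (by omega)
  have hS : S = Multiset.replicate (n - 1) g := by
    refine Multiset.eq_replicate.2 ⟨hlen, ?_⟩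
    intro b hb
    by_contra hne
    obtain ⟨R, rfl⟩ := Multiset.exists_cons_of_mem hg
    have hb' : b ∈ R := (Multiset.mem_cons.1 hb).resolve_left hne
    obtain ⟨Q, rfl⟩ := Multiset.exists_cons_of_mem hb'
    have e : g ::ₘ b ::ₘ Q = Q + (g ::ₘ b ::ₘ 0) := by
      rw [add_comm]; simp
    rw [e] at hzsf hlen
    have h1 := card_subSums_add _ _ hzsf
    have h2 := four_le_subSums g b (Ne.symm hne)
      (fun T hT => hzsf T (hT.trans (Multiset.le_add_left _ _)))
    have h3 := Finset.card_le_univ (subSums (Q + (g ::ₘ b ::ₘ 0)))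
    simp only [Multiset.card_add, Multiset.card_cons, Multiset.card_zero] at hlen
    omega
  refine ⟨g, ?_, hS⟩
  have hle : addOrderOf g ≤ n := hcard ▸ addOrderOf_le_card_univ
  have hpos : 0 < addOrderOf g := addOrderOf_pos g
  by_contra hne
  refine hzsf (Multiset.replicate (addOrderOf g) g) ?_ ?_ ?_
  · rw [hS]
    exact Multiset.replicate_le_replicate g |>.2 (by omega)
  · intro h
    have := congrArg Multiset.card h
    rw [Multiset.card_replicate, Multiset.card_zero] at this
    omega
  · simp [addOrderOf_nsmul_eq_zero]
end

section
/- Let G be an additively written cyclic group of order n ≥ 4 and let S be a zero-sum free sequence over G of length |S| ≥ (n+1)/2. Then there exists g ∈ G with ord(g) = n such that S is g-smooth and, for every subsequence W of S with |W| ≥ n/2 - 1, the element g occurs in W. -/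
/-- The set of sums of non-empty subsequences (multiset divisors) of `S`. -/
def SubseqSums {G : Type*} [AddCommGroup G] (S : Multiset G) : Set G :=
  {h | ∃ T : Multiset G, T ≤ S ∧ T ≠ 0 ∧ T.sum = h}

/-- A sequence `S` is *`g`-smooth* if `S = (n₁ g) · … · (n_ℓ g)` with
`1 = n₁ ≤ … ≤ n_ℓ`, `m = n₁ + … + n_ℓ < ord g` and `Σ(S) = {g, 2g, …, mg}`. -/
def IsSmooth {G : Type*} [AddCommGroup G] (g : G) (S : Multiset G) : Prop :=
  ∃ c : Multiset ℕ, S = c.map (fun k => k • g) ∧ (∀ k ∈ c, 1 ≤ k) ∧ 1 ∈ c ∧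
    c.sum < addOrderOf g ∧ SubseqSums S = (fun k => k • g) '' Set.Icc 1 c.sum

/-- Subsequence sums, the empty subsequence included, as a finset. -/
noncomputable def sumsZ {G : Type*} [AddCommGroup G] (S : Multiset G) : Finset G := by
  classical exact (S.powerset.map Multiset.sum).toFinset

lemma mem_sumsZ {G : Type*} [AddCommGroup G] {S : Multiset G} {x : G} :
    x ∈ sumsZ S ↔ ∃ T, T ≤ S ∧ T.sum = x := by
  simp [sumsZ]

lemma mem_sumsZ_cons {G : Type*} [AddCommGroup G] {S : Multiset G} {b x : G} :
    x ∈ sumsZ (b ::ₘ S) ↔ x ∈ sumsZ S ∨ ∃ y ∈ sumsZ S, y + b = x := by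
  classical
  simp only [sumsZ, Multiset.powerset_cons, Multiset.map_add, Multiset.toFinset_add,
    Finset.mem_union]
  simp [add_comm]

lemma sumsZ_sum {G : Type*} [AddCommGroup G] (S : Multiset G) : S.sum ∈ sumsZ S :=
  mem_sumsZ.2 ⟨S, le_rfl, rfl⟩

lemma sumsZ_symm {G : Type*} [AddCommGroup G] {S : Multiset G} {x : G} (h : x ∈ sumsZ S) :
    S.sum - x ∈ sumsZ S := by
  classical
  obtain ⟨T, hT, rfl⟩ := mem_sumsZ.1 h
  refine mem_sumsZ.2 ⟨S - T, Multiset.sub_le_self _ _, ?_⟩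
  have : (S - T + T).sum = S.sum := by rw [Multiset.sub_add_cancel hT]
  rw [Multiset.sum_add] at this
  rw [← this]; abel

lemma zsf_cons {G : Type*} [AddCommGroup G] {S : Multiset G} {b : G}
    (hz : IsZeroSumFree (b ::ₘ S)) {x : G} (hx : x ∈ sumsZ S) : x + b ≠ 0 := by
  obtain ⟨T, hT, rfl⟩ := mem_sumsZ.1 hx
  have := hz (b ::ₘ T) (Multiset.cons_le_cons b hT) (by simp)
  rw [Multiset.sum_cons] at this
  rwa [add_comm]

/-- Internal version of smoothness. -/
def Smo {G : Type*} [AddCommGroup G] (g : G) (S : Multiset G) : Prop :=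
  ∃ c : Multiset ℕ, S = c.map (fun k => k • g) ∧ (∀ k ∈ c, 1 ≤ k) ∧ 1 ∈ c ∧
    c.sum < addOrderOf g ∧ ∀ x, x ∈ sumsZ S ↔ ∃ k ≤ c.sum, k • g = x

lemma card_le_sum_of_pos (c : Multiset ℕ) (h : ∀ k ∈ c, 1 ≤ k) : Multiset.card c ≤ c.sum := by
  have := Multiset.card_nsmul_le_sum h
  simpa using this

/-- All removals change the sumset by one element: constant sequence. -/
lemma all_eq {G : Type*} [AddCommGroup G] {S : Multiset G} (hz : IsZeroSumFree S)
    (h : ∀ b S', S = b ::ₘ S' → (sumsZ S).card ≤ (sumsZ S').card + 1) :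
    ∀ b ∈ S, ∀ c ∈ S, b = c := by
  classical
  have key : ∀ b S', S = b ::ₘ S' → sumsZ S' = (sumsZ S).erase S.sum := by
    intro b S' hS
    have h1 := h b S' hS
    have hsub : sumsZ S' ⊆ (sumsZ S).erase S.sum := by
      intro x hx
      rw [Finset.mem_erase]
      refine ⟨?_, by rw [hS, mem_sumsZ_cons]; exact Or.inl hx⟩
      rintro rfl
      have h2 := sumsZ_symm hx
      subst hS
      apply zsf_cons hz h2
      simp
    apply Finset.eq_of_subset_of_card_le hsub
    rw [Finset.card_erase_of_mem (sumsZ_sum S)]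
    omega
  intro b hb c hc
  obtain ⟨B, hB⟩ := Multiset.exists_cons_of_mem hb
  obtain ⟨C, hC⟩ := Multiset.exists_cons_of_mem hc
  have kB := key b B hB
  have kC := key c C hC
  have sB : S.sum = b + B.sum := by rw [hB]; simp
  have sC : S.sum = c + C.sum := by rw [hC]; simp
  by_contra hne
  -- `C.sum + b` lies in the sumset
  have m1 : C.sum ∈ sumsZ B := by rw [kB, ← kC]; exact sumsZ_sum C
  have m2 : C.sum + b ∈ sumsZ S := by
    rw [hB, mem_sumsZ_cons]; exact Or.inr ⟨_, m1, rfl⟩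
  have m3 : C.sum + b ∈ sumsZ B := by
    rw [kB, Finset.mem_erase]
    refine ⟨?_, m2⟩
    rw [sC, add_comm]
    intro e
    exact hne (add_right_cancel e)
  have m4 : C.sum - (C.sum + b) ∈ sumsZ C := sumsZ_symm (by rw [kC, ← kB]; exact m3)
  have m4' : C.sum - (C.sum + b) ∈ sumsZ B := by rw [kB, ← kC]; exact m4
  have m5 := sumsZ_symm m4'
  have : B.sum - (C.sum - (C.sum + b)) = S.sum := by rw [sB]; abel
  rw [this, kB] at m5
  simp at m5

lemma smo_replicate {G : Type*} [AddCommGroup G] [Finite G] (g : G) (l : ℕ) (hl : 1 ≤ l)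
    (hz : IsZeroSumFree (Multiset.replicate l g)) : Smo g (Multiset.replicate l g) := by
  refine ⟨Multiset.replicate l 1, by simp, ?_, ?_, ?_, ?_⟩
  · intro k hk
    rw [Multiset.eq_of_mem_replicate hk]
  · rw [Multiset.mem_replicate]; exact ⟨by omega, rfl⟩
  · simp only [Multiset.sum_replicate, smul_eq_mul, mul_one]
    by_contra hcon
    have hpos := addOrderOf_pos g
    refine hz (Multiset.replicate (addOrderOf g) g)
      ((Multiset.replicate_le_replicate g).2 (by omega)) ?_ ?_
    · intro h0
      have := congrArg Multiset.card h0
      simp only [Multiset.card_replicate, Multiset.card_zero] at this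
      omega
    · rw [Multiset.sum_replicate, addOrderOf_nsmul_eq_zero]
  · intro x
    simp only [Multiset.sum_replicate, smul_eq_mul, mul_one]
    rw [mem_sumsZ]
    constructor
    · rintro ⟨T, hT, rfl⟩
      obtain ⟨k, hk, rfl⟩ := Multiset.le_replicate_iff.1 hT
      exact ⟨k, hk, by simp⟩
    · rintro ⟨k, hk, rfl⟩
      exact ⟨Multiset.replicate k g, (Multiset.replicate_le_replicate g).2 hk, by simp⟩

lemma smo_cons {G : Type*} [AddCommGroup G] {g b : G} {S : Multiset G}
    (hz : IsZeroSumFree (b ::ₘ S)) (hS : Smo g S)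
    (hc : (sumsZ (b ::ₘ S)).card + 1 ≤ 2 * (Multiset.card S + 1)) : Smo g (b ::ₘ S) := by
  classical
  obtain ⟨c, hSc, hpos, h1, hlt, hP⟩ := hS
  have hcardS : Multiset.card S ≤ c.sum := by
    have := card_le_sum_of_pos c hpos
    rw [hSc]; simpa using this
  have hPeq : sumsZ S = (Finset.range (c.sum + 1)).image (fun k => k • g) := by
    ext x
    rw [hP]
    simp [Nat.lt_succ_iff]
  have hPcard : (sumsZ S).card = c.sum + 1 := by
    rw [hPeq, Finset.card_image_of_injOn, Finset.card_range]
    intro i hi j hj hij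
    simp only [Finset.coe_range, Set.mem_Iio] at hi hj
    exact nsmul_injOn_Iio_addOrderOf (Set.mem_Iio.2 (by omega)) (Set.mem_Iio.2 (by omega)) hij
  have hUn : sumsZ (b ::ₘ S) = sumsZ S ∪ (sumsZ S).image (fun y => y + b) := by
    ext x
    rw [mem_sumsZ_cons, Finset.mem_union, Finset.mem_image]
  have hnd : ¬ Disjoint (sumsZ S) ((sumsZ S).image (fun y => y + b)) := by
    intro hd
    rw [hUn, Finset.card_union_of_disjoint hd,
      Finset.card_image_of_injective _ (add_left_injective b)] at hc
    omega
  rw [Finset.not_disjoint_iff] at hnd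
  obtain ⟨x, hx, hx'⟩ := hnd
  obtain ⟨y, hy, rfl⟩ := Finset.mem_image.1 hx'
  obtain ⟨i, hi, hi'⟩ := (hP _).1 hx
  obtain ⟨j, hj, rfl⟩ := (hP _).1 hy
  have hji : j < i := by
    by_contra hcon
    obtain ⟨d, rfl⟩ := Nat.exists_eq_add_of_le (not_lt.1 hcon)
    refine zsf_cons hz ((hP (d • g)).2 ⟨d, by omega, rfl⟩) ?_
    rw [add_nsmul, add_assoc] at hi'
    exact left_eq_add.1 hi'
  obtain ⟨k, rfl⟩ := Nat.exists_eq_add_of_lt hji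
  have hb : b = (k + 1) • g := by
    rw [add_assoc, add_nsmul] at hi'
    exact (add_left_cancel hi').symm
  have hsum : (k + 1) + c.sum < addOrderOf g := by
    by_contra hcon
    refine zsf_cons hz ((hP ((addOrderOf g - (k + 1)) • g)).2 ⟨_, by omega, rfl⟩) ?_
    rw [hb, ← add_nsmul, Nat.sub_add_cancel (by omega), addOrderOf_nsmul_eq_zero]
  refine ⟨(k + 1) ::ₘ c, by rw [Multiset.map_cons, ← hSc, hb], ?_, ?_, ?_, ?_⟩
  · intro q hq
    rcases Multiset.mem_cons.1 hq with rfl | hq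
    · omega
    · exact hpos q hq
  · exact Multiset.mem_cons_of_mem h1
  · simpa using hsum
  · intro x
    rw [mem_sumsZ_cons, Multiset.sum_cons]
    constructor
    · rintro (h | ⟨y, hy, rfl⟩)
      · obtain ⟨q, hq, rfl⟩ := (hP _).1 h
        exact ⟨q, by omega, rfl⟩
      · obtain ⟨q, hq, rfl⟩ := (hP _).1 hy
        exact ⟨q + (k + 1), by omega, by rw [add_nsmul, ← hb]⟩
    · rintro ⟨q, hq, rfl⟩
      by_cases hqc : q ≤ c.sum
      · exact Or.inl ((hP _).2 ⟨q, hqc, rfl⟩)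
      · refine Or.inr ⟨(q - (k + 1)) • g, (hP _).2 ⟨_, by omega, rfl⟩, ?_⟩
        rw [hb, ← add_nsmul, Nat.sub_add_cancel (by omega)]

/-- The Savchev–Chen structure theorem in terms of the size of the sumset. -/
lemma smo_of_card {G : Type*} [AddCommGroup G] [Finite G] (N : ℕ) : ∀ S : Multiset G,
    Multiset.card S = N → IsZeroSumFree S → (sumsZ S).card + 1 ≤ 2 * N → ∃ g, Smo g S := by
  induction N with
  | zero => intro S _ _ h; omega
  | succ N ih =>
    intro S hS hz hc
    by_cases hall : ∀ b S', S = b ::ₘ S' → (sumsZ S).card ≤ (sumsZ S').card + 1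
    · have heq := all_eq hz hall
      obtain ⟨b, hb⟩ := Multiset.card_pos_iff_exists_mem.1 (by omega : 0 < Multiset.card S)
      have hr : S = Multiset.replicate (N + 1) b :=
        Multiset.eq_replicate.2 ⟨hS, fun c hc => heq c hc b hb⟩
      refine ⟨b, ?_⟩
      rw [hr] at hz ⊢
      exact smo_replicate b _ (by omega) hz
    · push Not at hall
      obtain ⟨b, S', rfl, hlt⟩ := hall
      have hS' : Multiset.card S' = N := by simpa using hS
      have hz' : IsZeroSumFree S' := fun T hT =>
        hz T (hT.trans (Multiset.le_cons_self S' b))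
      obtain ⟨g, hg⟩ := ih S' hS' hz' (by omega)
      exact ⟨g, smo_cons hz hg (by rw [hS']; exact hc)⟩

theorem zero_sum_free_long_generator_in_long_subsequences
    (n : ℕ) (hn : 4 ≤ n)
    (G : Type*) [AddCommGroup G] [Fintype G] (hcyc : IsAddCyclic G)
    (hcard : Fintype.card G = n)
    (S : Multiset G) (hzsf : IsZeroSumFree S) (hlen : n + 1 ≤ 2 * Multiset.card S) :
    ∃ g : G, addOrderOf g = n ∧ IsSmooth g S ∧
      ∀ W : Multiset G, W ≤ S → n ≤ 2 * Multiset.card W + 2 → g ∈ W := by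
  classical
  obtain ⟨g, c, hSc, hpos, h1, hlt, hP⟩ := smo_of_card (Multiset.card S) S rfl hzsf (by
    have := Finset.card_le_univ (sumsZ S)
    omega)
  have hcardS : Multiset.card S = Multiset.card c := by rw [hSc]; simp
  have hcs := card_le_sum_of_pos c hpos
  have hord : addOrderOf g = n := by
    obtain ⟨q, hq⟩ : addOrderOf g ∣ n := hcard ▸ addOrderOf_dvd_card
    have : q = 1 := by
      rcases q with _ | _ | q
      · omega
      · rfl
      · exfalso
        have : addOrderOf g * 2 ≤ addOrderOf g * (q + 1 + 1) := Nat.mul_le_mul_left _ (by omega)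
        omega
    rw [this] at hq; omega
  refine ⟨g, hord, ⟨c, hSc, hpos, h1, hlt, ?_⟩, ?_⟩
  · ext x
    constructor
    · rintro ⟨T, hT, hT0, rfl⟩
      obtain ⟨k, hk, hk'⟩ := (hP _).1 (mem_sumsZ.2 ⟨T, hT, rfl⟩)
      refine ⟨k, ⟨?_, hk⟩, hk'⟩
      rcases k with _ | k
      · exact absurd (by rw [← hk', zero_nsmul]) (hzsf T hT hT0)
      · omega
    · rintro ⟨k, ⟨hk1, hk⟩, rfl⟩
      obtain ⟨T, hT, hT'⟩ := mem_sumsZ.1 ((hP _).2 ⟨k, hk, rfl⟩)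
      refine ⟨T, hT, ?_, hT'⟩
      rintro rfl
      have hd : addOrderOf g ∣ k := addOrderOf_dvd_of_nsmul_eq_zero (by rw [← hT']; simp)
      have := Nat.le_of_dvd (by omega) hd
      omega
  · intro W hW hWc
    by_contra hgW
    -- the ones of `c` are mapped to copies of `g`, all of which lie outside `W`
    have hcount : Multiset.card W + Multiset.count g S ≤ Multiset.card S := by
      have h2 : W + Multiset.replicate (Multiset.count g S) g ≤ S := by
        rw [Multiset.le_iff_count]
        intro a
        rw [Multiset.count_add, Multiset.count_replicate]
        split_ifs with h
        · subst h
          rw [Multiset.count_eq_zero_of_notMem hgW]; omega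
        · simpa using Multiset.count_le_of_le a hW
      simpa using Multiset.card_le_card h2
    have hcg : Multiset.count 1 c ≤ Multiset.count g S := by
      have h2 : Multiset.replicate (Multiset.count 1 c) 1 ≤ c :=
        Multiset.le_count_iff_replicate_le.1 le_rfl
      have h3 := Multiset.map_le_map (f := fun k : ℕ => k • g) h2
      rw [Multiset.map_replicate, one_nsmul, ← hSc] at h3
      exact Multiset.le_count_iff_replicate_le.2 h3
    have hsum : ∀ d : Multiset ℕ, (∀ k ∈ d, 1 ≤ k) →
        2 * Multiset.card d ≤ d.sum + Multiset.count 1 d := by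
      intro d
      induction d using Multiset.induction_on with
      | empty => simp
      | cons a d ih =>
        intro h
        have h1 := ih (fun k hk => h k (Multiset.mem_cons_of_mem hk))
        have h2 := h a (Multiset.mem_cons_self a d)
        rw [Multiset.card_cons, Multiset.sum_cons, Multiset.count_cons]
        split_ifs <;> omega
    have := hsum c hpos
    omega
end

section
/- Let G be a finite group with |G| ≥ 3 and let j ∈ ℕ with j ≥ 2. Then there exists L ∈ L(G) with {2, j} ⊆ L if and only if j ≤ D(G). -/
/-- A multiset over a group is a *product-one sequence* if its terms can be
ordered so that their product is `1`. -/
def IsProductOne {G : Type*} [Group G] (S : Multiset G) : Prop :=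
  ∃ l : List G, (l : Multiset G) = S ∧ l.prod = 1

/-- A product-one sequence is *minimal* (an atom of `B(G)`) if it is non-trivial
and cannot be written as a concatenation of two non-trivial product-one
sequences. -/
def IsMinimalProductOne {G : Type*} [Group G] (S : Multiset G) : Prop :=
  S ≠ 0 ∧ IsProductOne S ∧
    ∀ T₁ T₂ : Multiset G, T₁ ≠ 0 → T₂ ≠ 0 → IsProductOne T₁ → IsProductOne T₂ →
      S ≠ T₁ + T₂

/-- The large Davenport constant `D(G)`: the maximal length of a minimal
product-one sequence over `G`. -/
noncomputable def DavenportLarge (G : Type*) [Group G] : ℕ :=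
  sSup {m | ∃ S : Multiset G, IsMinimalProductOne S ∧ Multiset.card S = m}

/-- `k ∈ L(a)`: the product-one sequence `a` is a concatenation of `k` minimal
product-one sequences. -/
def HasLength {G : Type*} [Group G] (a : Multiset G) (k : ℕ) : Prop :=
  ∃ f : Fin k → Multiset G, (∀ i, IsMinimalProductOne (f i)) ∧ (∑ i, f i) = a

/-- `U_k(G)`: the union of all sets of lengths `L(a)` with `k ∈ L(a)`. -/
def UnionLengths (G : Type*) [Group G] (k : ℕ) : Set ℕ :=
  {m | ∃ a : Multiset G, IsProductOne a ∧ HasLength a k ∧ HasLength a m}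

/-- `ρ_k(G) = sup U_k(G)`. -/
noncomputable def rhoK (G : Type*) [Group G] (k : ℕ) : ℕ :=
  sSup (UnionLengths G k)

/-- `λ_k(G) = min U_k(G)`. -/
noncomputable def lambdaK (G : Type*) [Group G] (k : ℕ) : ℕ :=
  sInf (UnionLengths G k)

theorem IsProductOne.add_aux {G : Type*} [Group G] {S T : Multiset G}
    (hS : IsProductOne S) (hT : IsProductOne T) : IsProductOne (S + T) := by
  obtain ⟨l, rfl, hl⟩ := hS
  obtain ⟨m, rfl, hm⟩ := hT
  exact ⟨l ++ m, by simp, by simp [hl, hm]⟩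

theorem isProductOne_one_aux {G : Type*} [Group G] : IsProductOne ({1} : Multiset G) :=
  ⟨[1], by simp, by simp⟩

theorem IsProductOne.map_inv_aux {G : Type*} [Group G] {S : Multiset G}
    (hS : IsProductOne S) : IsProductOne (S.map (·⁻¹)) := by
  obtain ⟨l, rfl, hl⟩ := hS
  refine ⟨(l.map (·⁻¹)).reverse, by simp, ?_⟩
  rw [← List.prod_inv_reverse, hl, inv_one]

theorem IsMinimalProductOne.map_inv_aux {G : Type*} [Group G] {S : Multiset G}
    (hS : IsMinimalProductOne S) : IsMinimalProductOne (S.map (·⁻¹)) := by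
  obtain ⟨h0, h1, h2⟩ := hS
  refine ⟨by simpa using h0, h1.map_inv_aux, ?_⟩
  intro T₁ T₂ a b c d h
  refine h2 (T₁.map (·⁻¹)) (T₂.map (·⁻¹)) (by simpa using a) (by simpa using b)
    c.map_inv_aux d.map_inv_aux ?_
  rw [← Multiset.map_add, ← h]
  simp

theorem IsProductOne.split_aux {G : Type*} [Group G] {x y : G} {R : Multiset G}
    (h : IsProductOne ((x * y) ::ₘ R)) : IsProductOne (x ::ₘ y ::ₘ R) := by
  obtain ⟨l, hl, hp⟩ := h
  have hm : x * y ∈ l := by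
    have : x * y ∈ (l : Multiset G) := by rw [hl]; simp
    simpa using this
  obtain ⟨s, t, rfl⟩ := List.append_of_mem hm
  refine ⟨s ++ x :: y :: t, ?_, by simpa [mul_assoc] using hp⟩
  have hR : ((s ++ t : List G) : Multiset G) = R := by
    apply (Multiset.cons_inj_right (x * y)).1
    rw [← hl, Multiset.cons_coe, Multiset.coe_eq_coe]
    exact List.perm_middle.symm
  rw [← hR, Multiset.cons_coe, Multiset.cons_coe, Multiset.coe_eq_coe]
  exact List.perm_middle.trans (List.Perm.cons _ List.perm_middle)

theorem IsMinimalProductOne.one_notMem_aux {G : Type*} [Group G] {S : Multiset G}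
    (hS : IsMinimalProductOne S) (h : 1 ∈ S) : S = {1} := by
  obtain ⟨h0, h1, h2⟩ := hS
  by_contra hne
  obtain ⟨l, rfl, hp⟩ := h1
  obtain ⟨s, t, rfl⟩ := List.append_of_mem (by simpa using h : (1 : G) ∈ l)
  have key : ((s ++ 1 :: t : List G) : Multiset G) = {1} + ((s ++ t : List G) : Multiset G) := by
    rw [Multiset.singleton_add, Multiset.cons_coe, Multiset.coe_eq_coe]
    exact List.perm_middle
  refine h2 {1} ((s ++ t : List G) : Multiset G) (by simp) ?_ isProductOne_one_aux
    ⟨_, rfl, by simpa using hp⟩ key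
  intro h
  rw [h] at key
  exact hne (by simpa using key)

theorem isMinimal_pair_aux {G : Type*} [Group G] {g : G} (hg : g ≠ 1) :
    IsMinimalProductOne ({g, g⁻¹} : Multiset G) := by
  refine ⟨by simp, ⟨[g, g⁻¹], by simp; rfl, by simp⟩, ?_⟩
  intro T₁ T₂ a b c d h
  have hc := congrArg Multiset.card h
  have h1 := Multiset.card_pos.2 a
  have h2 := Multiset.card_pos.2 b
  simp only [Multiset.insert_eq_cons, Multiset.card_cons, Multiset.card_singleton,
    Multiset.card_add] at hc
  obtain ⟨x, rfl⟩ := Multiset.card_eq_one.1 (by omega : Multiset.card T₁ = 1)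
  obtain ⟨l, hl, hp⟩ := c
  have hl' : l = [x] := by simpa using hl
  subst hl'
  have hx : x = 1 := by simpa using hp
  have : x ∈ ({g, g⁻¹} : Multiset G) := by rw [h]; simp
  subst hx
  simp at this
  rcases this with h | h
  · exact hg h.symm
  · exact hg (by simpa using h)

theorem shrink_aux {G : Type*} [Group G] {S : Multiset G} {n : ℕ} (hn : 1 ≤ n)
    (hS : IsMinimalProductOne S) (hc : Multiset.card S = n + 1) :
    ∃ T : Multiset G, IsMinimalProductOne T ∧ Multiset.card T = n := by
  obtain ⟨h0, ⟨l, rfl, hp⟩, h2⟩ := hS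
  match l, hc, hp, h2 with
  | [], hc, _, _ => simp at hc
  | [x], hc, _, _ => simp at hc; omega
  | x :: y :: l, hc, hp, h2 =>
    refine ⟨(((x * y) :: l : List G) : Multiset G),
      ⟨by simp, ⟨_, rfl, by simpa [mul_assoc] using hp⟩, ?_⟩, by simpa using hc⟩
    have key : ∀ T₁ T₂ : Multiset G, T₁ ≠ 0 → T₂ ≠ 0 → IsProductOne T₁ → IsProductOne T₂ →
        (((x * y) :: l : List G) : Multiset G) = T₁ + T₂ → x * y ∈ T₁ → False := by
      intro T₁ T₂ a b c d h hm
      obtain ⟨R, rfl⟩ := Multiset.exists_cons_of_mem hm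
      refine h2 (x ::ₘ y ::ₘ R) T₂ (by simp) b c.split_aux d ?_
      rw [← Multiset.cons_coe, Multiset.cons_add, Multiset.cons_inj_right] at h
      rw [← Multiset.cons_coe, ← Multiset.cons_coe, h, Multiset.cons_add, Multiset.cons_add]
    intro T₁ T₂ a b c d h
    have hm : x * y ∈ T₁ + T₂ := by rw [← h]; simp
    rcases Multiset.mem_add.1 hm with hm | hm
    · exact key T₁ T₂ a b c d h hm
    · exact key T₂ T₁ b a d c (by rw [h, add_comm]) hm

theorem card_le_aux {G : Type*} [Group G] [Finite G] {S : Multiset G}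
    (hS : IsMinimalProductOne S) : Multiset.card S ≤ Nat.card G := by
  obtain ⟨h0, ⟨l, rfl, hp⟩, h2⟩ := hS
  by_contra! hlt
  have := Fintype.ofFinite G
  have hlt' : Fintype.card G < Fintype.card (Fin l.length) := by
    simpa [Nat.card_eq_fintype_card] using hlt
  obtain ⟨i, k, hik, he⟩ := Fintype.exists_ne_map_eq_of_card_lt
    (fun i : Fin l.length => (l.take i).prod) hlt'
  have key : ∀ i k : ℕ, i < k → k < l.length → (l.take i).prod = (l.take k).prod → False := by
    intro i k hik hk he
    have e1 : l.take k = l.take i ++ (l.take k).drop i := by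
      conv_lhs => rw [← List.take_append_drop i (l.take k)]
      rw [List.take_take, min_eq_left hik.le]
    have e2 : l = l.take i ++ (l.take k).drop i ++ l.drop k := by
      rw [← e1, List.take_append_drop]
    have hm : ((l.take k).drop i).prod = 1 := by
      have := congrArg List.prod e1
      rw [List.prod_append, ← he] at this
      simpa using this
    have hr : (l.take i ++ l.drop k).prod = 1 := by
      have := congrArg List.prod e2
      rw [List.prod_append, List.prod_append, hm, hp] at this
      simpa using this.symm
    refine h2 ((l.take k).drop i : List G) (l.take i ++ l.drop k : List G) ?_ ?_
      ⟨_, rfl, hm⟩ ⟨_, rfl, hr⟩ ?_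
    · intro h
      have := congrArg Multiset.card h
      simp at this
      omega
    · intro h
      have := congrArg Multiset.card h
      simp at this
      omega
    · conv_lhs => rw [e2]
      simp only [← Multiset.coe_add]
      abel
  have hne : (i : ℕ) ≠ k := fun h => hik (Fin.ext h)
  rcases lt_or_gt_of_ne hne with h | h
  · exact key i k h k.2 he
  · exact key k i h i.2 he.symm

theorem hasLength_pairs_aux {G : Type*} [Group G] (S : Multiset G) (h : ∀ g ∈ S, g ≠ 1) :
    HasLength (S + S.map (·⁻¹)) (Multiset.card S) := by
  induction S using Multiset.induction_on with
  | empty => exact ⟨fun _ => 0, fun i => i.elim0, by simp⟩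
  | cons g S ih =>
    obtain ⟨f, hf, hs⟩ := ih fun x hx => h x (Multiset.mem_cons_of_mem hx)
    rw [Multiset.card_cons]
    refine ⟨Fin.cons {g, g⁻¹} f, ?_, ?_⟩
    · intro i
      refine Fin.cases ?_ (fun i => ?_) i
      · simpa using isMinimal_pair_aux (h g (by simp))
      · simpa using hf i
    · rw [Fin.sum_univ_succ]
      simp only [Fin.cons_zero, Fin.cons_succ, hs, Multiset.map_add, Multiset.map_singleton,
        Multiset.insert_eq_cons, ← Multiset.singleton_add]
      abel

theorem bddAbove_aux (G : Type*) [Group G] [Finite G] :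
    BddAbove {m | ∃ S : Multiset G, IsMinimalProductOne S ∧ Multiset.card S = m} := by
  refine ⟨Nat.card G, ?_⟩
  rintro m ⟨S, hS, rfl⟩
  exact card_le_aux hS

theorem card_le_davenport_aux {G : Type*} [Group G] [Finite G] {S : Multiset G}
    (hS : IsMinimalProductOne S) : Multiset.card S ≤ DavenportLarge G :=
  le_csSup (bddAbove_aux G) ⟨S, hS, rfl⟩

theorem exists_card_aux {G : Type*} [Group G] {S : Multiset G} (hS : IsMinimalProductOne S)
    (j : ℕ) (hj : 1 ≤ j) (d : ℕ) (h : Multiset.card S = j + d) :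
    ∃ T : Multiset G, IsMinimalProductOne T ∧ Multiset.card T = j := by
  induction d generalizing S with
  | zero => exact ⟨S, hS, h⟩
  | succ d ih =>
    obtain ⟨T, hT, hc⟩ := shrink_aux (n := j + d) (by omega) hS (by omega)
    exact ih hT hc

theorem isProductOne_sum_aux {G : Type*} [Group G] {ι : Type*} (s : Finset ι)
    (f : ι → Multiset G) (h : ∀ i, IsMinimalProductOne (f i)) :
    IsProductOne (∑ i ∈ s, f i) := by
  classical
  induction s using Finset.induction_on with
  | empty => exact ⟨[], by simp, by simp⟩
  | insert a s ha ih =>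
    rw [Finset.sum_insert ha]
    exact (h a).2.1.add_aux ih

theorem one_aux {G : Type*} [Group G] {j : ℕ} (hj : 3 ≤ j) (U : Multiset G)
    (hU : IsMinimalProductOne U) (f : Fin j → Multiset G)
    (hf : ∀ i, IsMinimalProductOne (f i)) (i : Fin j) (hi : f i = {1})
    (h : ∑ i, f i = {1} + U) : False := by
  classical
  rw [← Finset.add_sum_erase _ _ (Finset.mem_univ i), hi] at h
  have h' := add_left_cancel h
  have hc : (Finset.univ.erase i).card = j - 1 := by simp
  obtain ⟨a, ha, b, hb, hab⟩ := Finset.one_lt_card.1 (by omega : 1 < (Finset.univ.erase i).card)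
  rw [← Finset.add_sum_erase _ _ ha] at h'
  refine hU.2.2 _ _ (hf a).1 ?_ (hf a).2.1 (isProductOne_sum_aux _ f hf) h'.symm
  intro h0
  exact (hf b).1 (Finset.sum_eq_zero_iff.1 h0 b (Finset.mem_erase.2 ⟨hab.symm, hb⟩))

theorem exists_length_set_containing_two_iff (G : Type*) [Group G] [Finite G]
    (hG : 3 ≤ Nat.card G) (j : ℕ) (hj : 2 ≤ j) :
    (∃ a : Multiset G, IsProductOne a ∧ HasLength a 2 ∧ HasLength a j) ↔
      j ≤ DavenportLarge G := by
  constructor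
  · rintro ⟨a, -, ⟨u, hu, rfl⟩, ⟨f, hf, hs⟩⟩
    rw [Fin.sum_univ_two] at hs
    rcases Nat.lt_or_ge 2 j with h3 | h2
    · by_cases hcard : ∀ i, 2 ≤ Multiset.card (f i)
      · have h1 := congrArg Multiset.card hs
        rw [Multiset.card_add, Multiset.card_sum] at h1
        have h4 := Finset.sum_le_sum (s := Finset.univ) fun i _ => hcard i
        simp only [Finset.sum_const, Finset.card_univ, Fintype.card_fin, smul_eq_mul] at h4
        have := card_le_davenport_aux (hu 0)
        have := card_le_davenport_aux (hu 1)
        omega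
      · exfalso
        push Not at hcard
        obtain ⟨i, hi⟩ := hcard
        have hpos := Multiset.card_pos.2 (hf i).1
        obtain ⟨x, hx⟩ := Multiset.card_eq_one.1 (by omega : Multiset.card (f i) = 1)
        obtain ⟨l, hl, hp⟩ := (hf i).2.1
        rw [hx] at hl
        have hl' : l = [x] := by simpa using hl
        subst hl'
        have hx1 : x = 1 := by simpa using hp
        subst hx1
        have hm : (1 : G) ∈ u 0 + u 1 := by
          rw [← hs, Multiset.mem_sum]
          exact ⟨i, Finset.mem_univ i, by simp [hx]⟩
        rcases Multiset.mem_add.1 hm with hm | hm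
        · rw [(hu 0).one_notMem_aux hm] at hs
          exact one_aux h3 _ (hu 1) f hf i hx hs
        · rw [(hu 1).one_notMem_aux hm, add_comm] at hs
          exact one_aux h3 _ (hu 0) f hf i hx hs
    · have : Nontrivial G := (Finite.one_lt_card_iff_nontrivial).1 (by omega)
      obtain ⟨g, hg⟩ := exists_ne (1 : G)
      have := card_le_davenport_aux (isMinimal_pair_aux hg)
      simp at this
      omega
  · intro h
    have hmem : DavenportLarge G ∈
        {m | ∃ S : Multiset G, IsMinimalProductOne S ∧ Multiset.card S = m} := by
      refine Nat.sSup_mem ?_ (bddAbove_aux G)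
      by_contra hne
      rw [Set.not_nonempty_iff_eq_empty] at hne
      rw [DavenportLarge, hne] at h
      simp at h
      omega
    obtain ⟨S, hS, hc⟩ := hmem
    obtain ⟨T, hT, rfl⟩ := exists_card_aux hS j (by omega) (DavenportLarge G - j) (by omega)
    refine ⟨T + T.map (·⁻¹), hT.2.1.add_aux hT.2.1.map_inv_aux,
      ⟨![T, T.map (·⁻¹)], ?_, by simp⟩, hasLength_pairs_aux T ?_⟩
    · intro i
      fin_cases i
      · exact hT
      · exact hT.map_inv_aux
    · rintro g hg rfl
      rw [hT.one_notMem_aux hg] at hj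
      simp at hj
end
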